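/- arXiv:math/0701738 — 4 statements merged into one kernel-verified Lean document; each statement's English description precedes it below -/
import Mathlib

section
/- Fix k with 1 ≤ k ≤ ℓ+1 and a function d : Γ → ℝ. The following are equivalent: (a) there exists a bounded linear operator B on H = ℓ²(Γ) such that B e_γ = (d(γ+ε_k) − d(γ))·c_k(γ)·e_{γ+ε_k} for all γ ∈ Γ (this B is the commutator [D,Z_k] of the diagonal operator D e_γ = d(γ) e_γ with Z_k); (b) there exists a constant C > 0 such that |d(γ+ε_k) − d(γ)| ≤ C·q^{−(γ(1)+…+γ(k−1))} for all γ ∈ Γ. -/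
open scoped BigOperators InnerProductSpace

noncomputable section

/-- The index set `Γ = ℕ^ℓ × ℤ`. -/
abbrev Gamma (ℓ : ℕ) : Type := (Fin ℓ → ℕ) × ℤ

/-- The Hilbert space `H = ℓ²(Γ)`. -/
abbrev Hsp (ℓ : ℕ) := lp (fun _ : Gamma ℓ => ℂ) 2

/-- The standard orthonormal basis vector `e_γ`. -/
def e (ℓ : ℕ) (γ : Gamma ℓ) : Hsp ℓ := lp.single 2 γ 1

/-- `ε_k ∈ Γ`: the element whose `k`-th coordinate is `1` and all other coordinates are `0`
(`k` is zero-indexed: `k : Fin (ℓ+1)` corresponds to the coordinate `k+1` of the paper). -/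
def eps (ℓ : ℕ) (k : Fin (ℓ+1)) : Gamma ℓ :=
  if h : (k : ℕ) < ℓ then (Pi.single ⟨(k : ℕ), h⟩ 1, 0) else (0, 1)

/-- The `k`-th coordinate of `γ ∈ Γ`, viewed in `ℤ` (zero-indexed). -/
def coord {ℓ : ℕ} (γ : Gamma ℓ) (k : Fin (ℓ+1)) : ℤ :=
  if h : (k : ℕ) < ℓ then (γ.1 ⟨(k : ℕ), h⟩ : ℤ) else γ.2

/-- `γ(1) + … + γ(k−1)` (sum of the coordinates strictly before position `k`). -/
def sumBelow {ℓ : ℕ} (k : Fin (ℓ+1)) (γ : Gamma ℓ) : ℕ :=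
  ∑ j ∈ Finset.univ.filter (fun j : Fin ℓ => (j : ℕ) < (k : ℕ)), γ.1 j

/-- The growth condition `|d(γ+ε_k) − d(γ)| ≤ c·q^{−(γ(1)+…+γ(k−1))}` for all `γ` and `k`. -/
def GrowthCondition (ℓ : ℕ) (q c : ℝ) (d : Gamma ℓ → ℝ) : Prop :=
  ∀ (k : Fin (ℓ+1)) (γ : Gamma ℓ),
    |d (γ + eps ℓ k) - d γ| ≤ c * (q ^ sumBelow k γ)⁻¹

/-- The coefficient `c_k(γ)`: for `1 ≤ k ≤ ℓ` (i.e. `(k:ℕ) < ℓ` in zero-indexing),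
`c_k(γ) = q^{γ(1)+…+γ(k−1)}·√(1 − q^{2(γ(k)+1)})`, and `c_{ℓ+1}(γ) = q^{γ(1)+…+γ(ℓ)}`. -/
def ck (ℓ : ℕ) (q : ℝ) (k : Fin (ℓ+1)) (γ : Gamma ℓ) : ℝ :=
  q ^ sumBelow k γ *
    (if h : (k : ℕ) < ℓ then Real.sqrt (1 - q ^ (2 * (γ.1 ⟨(k : ℕ), h⟩ + 1))) else 1)

/-- A weighted shift along an injective map of the index set, with bounded weights, extends to a
bounded operator on `ℓ²`. -/
theorem exists_weightedShift {ι : Type*} [DecidableEq ι] {f : ι → ι}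
    (hf : Function.Injective f) {w : ι → ℂ} {M : ℝ} (hw : ∀ i, ‖w i‖ ≤ M) :
    ∃ B : lp (fun _ : ι => ℂ) 2 →L[ℂ] lp (fun _ : ι => ℂ) 2,
      ∀ i, B (lp.single 2 i 1) = w i • lp.single 2 (f i) 1 := by
  have ho : Orthonormal ℂ fun i => (lp.single 2 (f i) (1 : ℂ) : lp (fun _ : ι => ℂ) 2) := by
    rw [orthonormal_iff_ite]
    intro i j
    rw [lp.inner_single_left, lp.single_apply]
    by_cases h : i = j
    · subst h
      simp
    · simp [h, hf.ne h]
  have hM (i : ι) : ‖w i • ContinuousLinearMap.id ℂ ℂ‖ ≤ max M 0 :=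
    le_max_of_le_left (by simpa [norm_smul] using hw i)
  let W := lp.mapCLM 2 (fun i => w i • ContinuousLinearMap.id ℂ ℂ) (le_max_right M 0) hM
  have hW (i : ι) : W (lp.single 2 i 1) = w i • lp.single 2 i 1 := by
    ext j
    by_cases h : j = i
    · subst h
      simp [W]
    · simp [W, h]
  refine ⟨ho.orthogonalFamily.linearIsometry.toContinuousLinearMap ∘L W, fun i => ?_⟩
  rw [ContinuousLinearMap.comp_apply, hW, map_smul]
  simp

theorem norm_e (ℓ : ℕ) (γ : Gamma ℓ) : ‖e ℓ γ‖ = 1 := by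
  simp [e, lp.norm_single]

theorem ck_nonneg (ℓ : ℕ) {q : ℝ} (hq : 0 ≤ q) (k : Fin (ℓ + 1)) (γ : Gamma ℓ) :
    0 ≤ ck ℓ q k γ := by
  unfold ck
  split_ifs <;> positivity

theorem ck_le (ℓ : ℕ) {q : ℝ} (hq : 0 ≤ q) (k : Fin (ℓ + 1)) (γ : Gamma ℓ) :
    ck ℓ q k γ ≤ q ^ sumBelow k γ := by
  unfold ck
  refine mul_le_of_le_one_right (by positivity) ?_
  split_ifs
  · exact Real.sqrt_le_one.mpr (sub_le_self _ (by positivity))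
  · exact le_rfl

theorem le_ck (ℓ : ℕ) {q : ℝ} (hq : 0 ≤ q) (hq1 : q ≤ 1) (k : Fin (ℓ + 1)) (γ : Gamma ℓ) :
    q ^ sumBelow k γ * Real.sqrt (1 - q ^ 2) ≤ ck ℓ q k γ := by
  unfold ck
  refine mul_le_mul_of_nonneg_left ?_ (by positivity)
  split_ifs
  · exact Real.sqrt_le_sqrt (sub_le_sub_left (pow_le_pow_of_le_one hq hq1 (by omega)) _)
  · exact Real.sqrt_le_one.mpr (sub_le_self _ (by positivity))

/-- boundedness of the commutator `[D, Z_k]` is equivalent to the growth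
condition `|d(γ+ε_k) − d(γ)| ≤ C·q^{−(γ(1)+…+γ(k−1))}`. -/
theorem stmt1 (ℓ : ℕ) (hℓ : 1 ≤ ℓ) (q : ℝ) (hq : 0 < q) (hq1 : q < 1)
    (k : Fin (ℓ+1)) (d : Gamma ℓ → ℝ) :
    (∃ B : Hsp ℓ →L[ℂ] Hsp ℓ, ∀ γ : Gamma ℓ,
        B (e ℓ γ) = (((d (γ + eps ℓ k) - d γ) * ck ℓ q k γ : ℝ) : ℂ) • e ℓ (γ + eps ℓ k))
      ↔
    (∃ C : ℝ, 0 < C ∧ ∀ γ : Gamma ℓ,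
        |d (γ + eps ℓ k) - d γ| ≤ C * (q ^ sumBelow k γ)⁻¹) := by
  constructor
  · rintro ⟨B, hB⟩
    have hs : 0 < Real.sqrt (1 - q ^ 2) :=
      Real.sqrt_pos.mpr (sub_pos.mpr (pow_lt_one₀ hq.le hq1 two_ne_zero))
    refine ⟨(‖B‖ + 1) / Real.sqrt (1 - q ^ 2), by positivity, fun γ => ?_⟩
    have hp : 0 < q ^ sumBelow k γ := by positivity
    have hn : |d (γ + eps ℓ k) - d γ| * ck ℓ q k γ ≤ ‖B‖ := by
      have h := B.le_opNorm (e ℓ γ)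
      rwa [hB, norm_smul, norm_e, norm_e, mul_one, mul_one, Complex.norm_real, Real.norm_eq_abs,
        abs_mul, abs_of_nonneg (ck_nonneg ℓ hq.le k γ)] at h
    have hl := mul_le_mul_of_nonneg_left (le_ck ℓ hq.le hq1.le k γ)
      (abs_nonneg (d (γ + eps ℓ k) - d γ))
    rw [← div_eq_mul_inv, div_div, le_div_iff₀ (by positivity)]
    linarith
  · rintro ⟨C, hC, h⟩
    refine exists_weightedShift (add_left_injective (eps ℓ k)) (M := C) fun γ => ?_
    have hp : 0 < q ^ sumBelow k γ := by positivity
    rw [Complex.norm_real, Real.norm_eq_abs, abs_mul, abs_of_nonneg (ck_nonneg ℓ hq.le k γ)]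
    calc |d (γ + eps ℓ k) - d γ| * ck ℓ q k γ
        ≤ C * (q ^ sumBelow k γ)⁻¹ * q ^ sumBelow k γ :=
          mul_le_mul (h γ) (ck_le ℓ hq.le k γ) (ck_nonneg ℓ hq.le k γ) (by positivity)
      _ = C := by field_simp
end
end

section
/- Let c > 0 and let d : Γ → ℝ satisfy the growth condition with constant c. Fix k with 1 ≤ k ≤ ℓ+2 and γ ∈ Γ, and let γ' ∈ Γ be the element with γ'(j) = 0 for j < k and γ'(j) = γ(j) for j ≥ k. Then there exists a finite sequence μ₀ = γ, μ₁, …, μ_m = γ' in Γ with m = |γ(1)| + … + |γ(k−1)| such that for every j: μ_j(i) = γ(i) for all i ≥ k, for each i < k the coordinate μ_j(i) lies between 0 and γ(i), and |d(μ_{j+1}) − d(μ_j)| ≤ c for 0 ≤ j < m. -/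
open scoped BigOperators InnerProductSpace

noncomputable section

lemma coord_injective {ℓ : ℕ} {γ δ : Gamma ℓ} (h : ∀ i, coord γ i = coord δ i) : γ = δ := by
  refine Prod.ext (funext fun j => ?_) ?_
  · simpa [coord] using h j.castSucc
  · simpa [coord] using h (Fin.last ℓ)

lemma coord_add_eps {ℓ : ℕ} (γ : Gamma ℓ) (i j : Fin (ℓ+1)) :
    coord (γ + eps ℓ i) j = coord γ j + if j = i then 1 else 0 := by
  rcases Nat.lt_or_ge j ℓ with hj | hj <;> rcases Nat.lt_or_ge i ℓ with hi | hi
  · simp [coord, eps, hi, hj, Pi.single_apply, Fin.ext_iff]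
  · have : j ≠ i := by intro h; subst h; omega
    simp [coord, eps, hj, hi.not_gt, this]
  · have : j ≠ i := by intro h; subst h; omega
    simp [coord, eps, hi, hj.not_gt, this]
  · have : j = i := by ext; omega
    subst this
    simp [coord, eps, hj.not_gt]

lemma exists_add_eps_eq {ℓ : ℕ} (γ : Gamma ℓ) {i : Fin (ℓ+1)} (hi : 0 < coord γ i) :
    ∃ δ : Gamma ℓ, δ + eps ℓ i = γ := by
  by_cases h : (i : ℕ) < ℓ
  · refine ⟨(γ.1 - Pi.single ⟨i, h⟩ 1, γ.2), ?_⟩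
    simp only [coord, h, dite_true] at hi
    refine Prod.ext (funext fun j => ?_) ?_
    · by_cases hj : j = ⟨i, h⟩
      · subst hj
        simp [eps, h]
        omega
      · simp [eps, h, hj]
    · simp [eps, h]
  · exact ⟨(γ.1, γ.2 - 1), by simp [eps, h]⟩

lemma sumBelow_eq_zero {ℓ : ℕ} {γ : Gamma ℓ} {i : Fin (ℓ+1)} (h : ∀ j < i, coord γ j = 0) :
    sumBelow i γ = 0 := by
  refine Finset.sum_eq_zero fun j hj => ?_
  simpa [coord] using h j.castSucc (by simpa [Fin.lt_def] using hj)

/-- If all coordinates before the nonzero coordinate `i` vanish, then `γ` can be moved one step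
towards `0` in direction `i` while changing `d` by at most `c`. -/
lemma GrowthCondition.exists_step {ℓ : ℕ} {q c : ℝ} {d : Gamma ℓ → ℝ}
    (hd : GrowthCondition ℓ q c d) (γ : Gamma ℓ) {i : Fin (ℓ+1)}
    (hi : coord γ i ≠ 0) (hlt : ∀ j < i, coord γ j = 0) :
    ∃ δ : Gamma ℓ, (∀ j ≠ i, coord δ j = coord γ j) ∧
      coord δ i = coord γ i - (coord γ i).sign ∧ |d δ - d γ| ≤ c := by
  rcases lt_or_gt_of_ne hi with hneg | hpos
  · refine ⟨γ + eps ℓ i, fun j hj => by simp [coord_add_eps, hj], ?_, ?_⟩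
    · simp [coord_add_eps, Int.sign_eq_neg_one_of_neg hneg]
    · simpa [sumBelow_eq_zero hlt] using hd i γ
  · obtain ⟨δ, rfl⟩ := exists_add_eps_eq γ hpos
    refine ⟨δ, fun j hj => by simp [coord_add_eps, hj], ?_, ?_⟩
    · rw [Int.sign_eq_one_of_pos hpos]
      simp [coord_add_eps]
    · have h0 : ∀ j < i, coord δ j = 0 := fun j hj => by
        simpa [coord_add_eps, hj.ne] using hlt j hj
      rw [abs_sub_comm]
      simpa [sumBelow_eq_zero h0] using hd i δ

lemma GrowthCondition.exists_path {ℓ : ℕ} {q c : ℝ} {d : Gamma ℓ → ℝ}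
    (hd : GrowthCondition ℓ q c d) (k : ℕ) (γ' : Gamma ℓ) (N : ℕ) (γ : Gamma ℓ)
    (hγ' : ∀ i : Fin (ℓ+1),
      ((i : ℕ) < k → coord γ' i = 0) ∧ (k ≤ (i : ℕ) → coord γ' i = coord γ i))
    (hN : ∑ i ∈ Finset.univ.filter (fun i : Fin (ℓ+1) => (i : ℕ) < k),
      (coord γ i).natAbs = N) :
    ∃ μ : ℕ → Gamma ℓ, μ 0 = γ ∧ μ N = γ' ∧
      (∀ j ≤ N,
        (∀ i : Fin (ℓ+1), k ≤ (i : ℕ) → coord (μ j) i = coord γ i) ∧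
        (∀ i : Fin (ℓ+1), (i : ℕ) < k →
          min 0 (coord γ i) ≤ coord (μ j) i ∧ coord (μ j) i ≤ max 0 (coord γ i))) ∧
      (∀ j < N, |d (μ (j+1)) - d (μ j)| ≤ c) := by
  induction N generalizing γ with
  | zero =>
    have hzero : ∀ i : Fin (ℓ+1), (i : ℕ) < k → coord γ i = 0 := by
      simpa [Finset.sum_eq_zero_iff] using hN
    refine ⟨fun _ => γ, rfl, coord_injective fun i => ?_, by simp, by simp⟩
    rcases Nat.lt_or_ge i k with hi | hi
    · rw [hzero i hi, (hγ' i).1 hi]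
    · exact ((hγ' i).2 hi).symm
  | succ N ih =>
    have hex : ∃ i : Fin (ℓ+1), (i : ℕ) < k ∧ coord γ i ≠ 0 := by
      by_contra! h
      rw [Finset.sum_eq_zero fun i hi => by simp [h i (by simpa using hi)]] at hN
      omega
    obtain ⟨i, ⟨hik, hi⟩, hmin⟩ :=
      WellFounded.has_min (wellFounded_lt (α := Fin (ℓ+1)))
        {i | (i : ℕ) < k ∧ coord γ i ≠ 0} hex
    have hlt : ∀ j < i, coord γ j = 0 := fun j hj => by
      by_contra h
      exact hmin j ⟨(Fin.lt_def.1 hj).trans hik, h⟩ hj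
    obtain ⟨δ, hne, heq, hstep⟩ := hd.exists_step γ hi hlt
    have hsign : coord γ i < 0 ∧ coord δ i = coord γ i + 1 ∨
        0 < coord γ i ∧ coord δ i = coord γ i - 1 := by
      rcases lt_or_gt_of_ne hi with h | h
      · exact Or.inl ⟨h, by rw [heq, Int.sign_eq_neg_one_of_neg h]; ring⟩
      · exact Or.inr ⟨h, by rw [heq, Int.sign_eq_one_of_pos h]⟩
    have hmem : i ∈ Finset.univ.filter (fun i : Fin (ℓ+1) => (i : ℕ) < k) := by simpa using hik
    have hδN : ∑ i ∈ Finset.univ.filter (fun i : Fin (ℓ+1) => (i : ℕ) < k),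
        (coord δ i).natAbs = N := by
      rw [← Finset.add_sum_erase _ _ hmem] at hN ⊢
      rw [Finset.sum_congr rfl fun j hj => by rw [hne j (Finset.ne_of_mem_erase hj)]]
      omega
    have hδ : ∀ j : Fin (ℓ+1), k ≤ (j : ℕ) → coord δ j = coord γ j := fun j hj =>
      hne j (by rintro rfl; omega)
    obtain ⟨μ, h0, hend, hbd, hd'⟩ := ih δ
      (fun j => ⟨(hγ' j).1, fun hj => by rw [(hγ' j).2 hj, hδ j hj]⟩) hδN
    refine ⟨fun n => Nat.casesOn n γ μ, rfl, hend, ?_, ?_⟩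
    · rintro (_ | n) hn
      · exact ⟨fun _ _ => rfl, fun _ _ => ⟨min_le_right _ _, le_max_right _ _⟩⟩
      · obtain ⟨h1, h2⟩ := hbd n (by omega)
        refine ⟨fun j hj => (h1 j hj).trans (hδ j hj), fun j hj => ?_⟩
        have := h2 j hj
        by_cases hji : j = i
        · subst hji
          dsimp only
          omega
        · rwa [hne j hji] at this
    · rintro (_ | n) hn
      · simpa [h0] using hstep
      · exact hd' n (by omega)

/-- path lemma to the truncation.  For `γ ∈ Γ` and its truncation `γ'`
(whose coordinates before position `k` are `0` and which agrees with `γ` from position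
`k` on), there is a path of length `|γ(1)| + … + |γ(k−1)|` from `γ` to `γ'` whose
vertices agree with `γ` from position `k` on, whose earlier coordinates lie between `0`
and the corresponding coordinate of `γ`, and whose consecutive `d`-values differ by at
most `c`.  (Here `k : ℕ`, `k ≤ ℓ+1`, zero-indexed: it corresponds to `1 ≤ k ≤ ℓ+2` of
the paper.) -/
theorem stmt3 (ℓ : ℕ) (hℓ : 1 ≤ ℓ) (q c : ℝ) (hq : 0 < q) (hq1 : q < 1) (hc : 0 < c)
    (d : Gamma ℓ → ℝ) (hd : GrowthCondition ℓ q c d)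
    (k : ℕ) (hk : k ≤ ℓ + 1) (γ γ' : Gamma ℓ)
    (hγ' : ∀ i : Fin (ℓ+1),
      ((i : ℕ) < k → coord γ' i = 0) ∧ (k ≤ (i : ℕ) → coord γ' i = coord γ i)) :
    ∃ μ : ℕ → Gamma ℓ,
      μ 0 = γ ∧
      μ (∑ i ∈ Finset.univ.filter (fun i : Fin (ℓ+1) => (i : ℕ) < k),
          (coord γ i).natAbs) = γ' ∧
      (∀ j ≤ ∑ i ∈ Finset.univ.filter (fun i : Fin (ℓ+1) => (i : ℕ) < k),
          (coord γ i).natAbs,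
        (∀ i : Fin (ℓ+1), k ≤ (i : ℕ) → coord (μ j) i = coord γ i) ∧
        (∀ i : Fin (ℓ+1), (i : ℕ) < k →
          min 0 (coord γ i) ≤ coord (μ j) i ∧ coord (μ j) i ≤ max 0 (coord γ i))) ∧
      (∀ j < ∑ i ∈ Finset.univ.filter (fun i : Fin (ℓ+1) => (i : ℕ) < k),
          (coord γ i).natAbs,
        |d (μ (j+1)) - d (μ j)| ≤ c) :=
  hd.exists_path k γ' _ γ hγ' rfl
end
end

section
/- The function d_torus : Γ → ℝ satisfies: (a) for every R > 0 the set {γ ∈ Γ : |d_torus(γ)| ≤ R} is finite; and (b) there exists a constant C > 0 such that |d_torus(γ+ε_k) − d_torus(γ)| ≤ C·q^{−(γ(1)+…+γ(k−1))} for all γ ∈ Γ and all 1 ≤ k ≤ ℓ+1. (Consequently the diagonal operator D_torus e_γ = d_torus(γ) e_γ is self-adjoint with compact resolvent and has bounded commutators with the generators Z₁,…,Z_{ℓ+1} of the quantum sphere algebra.) -/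
open scoped BigOperators InnerProductSpace

noncomputable section

/-- The eigenvalue function of the optimal equivariant Dirac operator `D_torus`:
`d_torus(γ) = ±(γ(1)+…+γ(ℓ)+|γ(ℓ+1)|)`, the sign being that of `γ(ℓ+1)`. -/
def dtorus (ℓ : ℕ) (γ : Gamma ℓ) : ℝ :=
  if 0 ≤ γ.2 then ((∑ j : Fin ℓ, γ.1 j : ℕ) + |(γ.2 : ℝ)|)
  else -(((∑ j : Fin ℓ, γ.1 j : ℕ) : ℝ) + |(γ.2 : ℝ)|)

theorem abs_dtorus (ℓ : ℕ) (γ : Gamma ℓ) :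
    |dtorus ℓ γ| = ((∑ j : Fin ℓ, γ.1 j : ℕ) : ℝ) + |(γ.2 : ℝ)| := by
  unfold dtorus
  split_ifs
  · exact abs_of_nonneg (by positivity)
  · rw [abs_neg]
    exact abs_of_nonneg (by positivity)

theorem finite_abs_dtorus_le (ℓ : ℕ) (R : ℝ) :
    {γ : Gamma ℓ | |dtorus ℓ γ| ≤ R}.Finite := by
  classical
  obtain ⟨N, hN⟩ := exists_nat_ge R
  refine (Set.finite_Icc ((fun _ => 0, -(N : ℤ)) : Gamma ℓ) (fun _ => N, (N : ℤ))).subset ?_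
  intro γ hγ
  rw [Set.mem_ofPred_eq, abs_dtorus] at hγ
  have h : (((∑ j : Fin ℓ, γ.1 j : ℕ) + |γ.2| : ℤ) : ℝ) ≤ ((N : ℤ) : ℝ) := by
    push_cast at hγ ⊢
    linarith
  have h' : ((∑ j : Fin ℓ, γ.1 j : ℕ) : ℤ) + |γ.2| ≤ N := by exact_mod_cast h
  have habs : |γ.2| ≤ N := by
    have := Int.natCast_nonneg (∑ j : Fin ℓ, γ.1 j)
    linarith
  refine ⟨⟨fun _ => Nat.zero_le _, (abs_le.mp habs).1⟩, fun j => ?_, (abs_le.mp habs).2⟩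
  have hj : γ.1 j ≤ ∑ j : Fin ℓ, γ.1 j :=
    Finset.single_le_sum (fun _ _ => Nat.zero_le _) (Finset.mem_univ j)
  have := abs_nonneg γ.2
  change γ.1 j ≤ N
  omega

theorem abs_dtorus_add_eps_sub_le_one (ℓ : ℕ) (k : Fin (ℓ+1)) (hk : (k : ℕ) < ℓ)
    (γ : Gamma ℓ) : |dtorus ℓ (γ + eps ℓ k) - dtorus ℓ γ| ≤ 1 := by
  simp only [dtorus, eps, hk, dif_pos, Prod.fst_add, Prod.snd_add, add_zero, Pi.add_apply,
    Finset.sum_add_distrib, Finset.sum_pi_single', Finset.mem_univ, if_true, Nat.cast_add,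
    Nat.cast_one]
  split_ifs <;> rw [abs_le] <;> constructor <;> linarith

theorem abs_dtorus_add_eps_sub_le (ℓ : ℕ) (k : Fin (ℓ+1)) (hk : ¬ (k : ℕ) < ℓ)
    (γ : Gamma ℓ) :
    |dtorus ℓ (γ + eps ℓ k) - dtorus ℓ γ| ≤ 1 + 2 * (sumBelow k γ : ℝ) := by
  have hS : sumBelow k γ = ∑ j : Fin ℓ, γ.1 j := by
    unfold sumBelow
    rw [Finset.filter_true_of_mem fun j _ => by omega]
  rw [hS]
  have hS0 : (0 : ℝ) ≤ ((∑ j : Fin ℓ, γ.1 j : ℕ) : ℝ) := Nat.cast_nonneg _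
  simp only [dtorus, eps, hk, dif_neg, not_false_eq_true, Prod.fst_add, Prod.snd_add, add_zero]
  generalize ((∑ j : Fin ℓ, γ.1 j : ℕ) : ℝ) = S at hS0 ⊢
  rcases lt_trichotomy γ.2 (-1) with h | h | h
  · have h1 : ((γ.2 + 1 : ℤ) : ℝ) < 0 := by exact_mod_cast (by omega : γ.2 + 1 < 0)
    have h2 : (γ.2 : ℝ) < 0 := by exact_mod_cast (by omega : γ.2 < 0)
    rw [if_neg (by omega), if_neg (by omega), abs_of_neg h1, abs_of_neg h2]
    push_cast
    rw [abs_le]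
    constructor <;> linarith
  · rw [h]
    norm_num
    rw [abs_le]
    constructor <;> linarith
  · have h1 : (0 : ℝ) ≤ ((γ.2 + 1 : ℤ) : ℝ) := by exact_mod_cast (by omega : 0 ≤ γ.2 + 1)
    have h2 : (0 : ℝ) ≤ (γ.2 : ℝ) := by exact_mod_cast (by omega : 0 ≤ γ.2)
    rw [if_pos (by omega), if_pos (by omega), abs_of_nonneg h1, abs_of_nonneg h2]
    push_cast
    rw [abs_le]
    constructor <;> linarith

theorem one_add_two_mul_le_inv_pow {q : ℝ} (hq : 0 < q) (hq1 : q < 1) (n : ℕ) :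
    1 + 2 * (n : ℝ) ≤ (1 + 2 / (q⁻¹ - 1)) * (q ^ n)⁻¹ := by
  have ha : 0 < q⁻¹ - 1 := sub_pos.mpr ((one_lt_inv₀ hq).mpr hq1)
  have hb : 1 + (n : ℝ) * (q⁻¹ - 1) ≤ (q ^ n)⁻¹ := by
    rw [← inv_pow]
    simpa using one_add_mul_le_pow (a := q⁻¹ - 1) (by linarith) n
  calc 1 + 2 * (n : ℝ)
      ≤ 1 + 2 * (n : ℝ) + (n * (q⁻¹ - 1) + 2 / (q⁻¹ - 1)) :=
        le_add_of_nonneg_right (by positivity)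
    _ = (1 + 2 / (q⁻¹ - 1)) * (1 + n * (q⁻¹ - 1)) := by
        generalize q⁻¹ - 1 = a at ha
        field_simp
        ring
    _ ≤ _ := by gcongr

/-- `d_torus` has finite level sets (so `D_torus` has compact resolvent)
and satisfies the growth condition (so `D_torus` has bounded commutators with the
generators `Z₁, …, Z_{ℓ+1}`). -/
theorem stmt6 (ℓ : ℕ) (hℓ : 1 ≤ ℓ) (q : ℝ) (hq : 0 < q) (hq1 : q < 1) :
    (∀ R : ℝ, 0 < R → {γ : Gamma ℓ | |dtorus ℓ γ| ≤ R}.Finite) ∧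
    (∃ C : ℝ, 0 < C ∧ GrowthCondition ℓ q C (dtorus ℓ)) := by
  refine ⟨fun R _ => finite_abs_dtorus_le ℓ R, 1 + 2 / (q⁻¹ - 1), ?_, fun k γ => ?_⟩
  · have ha : 0 < q⁻¹ - 1 := sub_pos.mpr ((one_lt_inv₀ hq).mpr hq1)
    positivity
  · refine le_trans ?_ (one_add_two_mul_le_inv_pow hq hq1 _)
    by_cases hk : (k : ℕ) < ℓ
    · exact (abs_dtorus_add_eps_sub_le_one ℓ k hk γ).trans
        (le_add_of_nonneg_right (by positivity))
    · exact abs_dtorus_add_eps_sub_le ℓ k hk γ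
end
end

section
/- Let Q be the orthogonal projection of H = ℓ²(Γ) onto the closed linear span of {e_γ : γ(i) = 0 for all 1 ≤ i ≤ ℓ}. Then the operator U := Q∘Z_{ℓ+1} + (1 − Q) is a unitary operator on H, and it satisfies U e_γ = e_{γ+ε_{ℓ+1}} if γ(i) = 0 for all 1 ≤ i ≤ ℓ, and U e_γ = e_γ otherwise. (U is the image under π_ℓ of the unitary u = χ_{\{1\}}(z_{ℓ+1}^* z_{ℓ+1})(z_{ℓ+1} − 1) + 1 ∈ C(S_q^{2ℓ+1}).) -/
open scoped BigOperators InnerProductSpace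

noncomputable section

/-- Continuous linear maps on `ℓ²(Γ)` agreeing on the standard basis are equal. -/
theorem clm_ext_e {ℓ : ℕ} {S T : Hsp ℓ →L[ℂ] Hsp ℓ} (h : ∀ γ, S (e ℓ γ) = T (e ℓ γ)) :
    S = T := by
  refine lp.ext_continuousLinearMap (by norm_num) fun γ => ?_
  ext1
  simpa [e] using h γ

theorem inner_e_left {ℓ : ℕ} (γ : Gamma ℓ) (x : Hsp ℓ) : inner ℂ (e ℓ γ) x = x γ := by
  simp [e, lp.inner_single_left]

/-- The adjoint of an operator permuting the standard basis permutes it inversely. -/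
theorem adjoint_apply_e {ℓ : ℕ} {T : Hsp ℓ →L[ℂ] Hsp ℓ} (σ : Equiv.Perm (Gamma ℓ))
    (hT : ∀ γ, T (e ℓ γ) = e ℓ (σ γ)) (γ : Gamma ℓ) :
    ContinuousLinearMap.adjoint T (e ℓ γ) = e ℓ (σ.symm γ) := by
  ext δ
  rw [← inner_e_left, ContinuousLinearMap.adjoint_inner_right, hT, inner_e_left]
  simp only [e, lp.coeFn_single, Pi.single_apply, Equiv.eq_symm_apply]

/-- The permutation of `Γ` shifting the last coordinate of those `γ` with
`γ(1) = … = γ(ℓ) = 0` and fixing the others. -/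
def shiftPerm (ℓ : ℕ) : Equiv.Perm (Gamma ℓ) :=
  Equiv.prodShear (Equiv.refl _) fun a => if a = 0 then Equiv.addRight 1 else Equiv.refl _

/-- with `Q` the orthogonal projection onto the closed span of
`{e_γ : γ(1) = … = γ(ℓ) = 0}` and `Z_{ℓ+1}` the last generator, the operator
`U = Q∘Z_{ℓ+1} + (1 − Q)` is unitary, shifts `e_γ ↦ e_{γ+ε_{ℓ+1}}` when
`γ(1) = … = γ(ℓ) = 0`, and fixes `e_γ` otherwise. -/
theorem stmt8 (ℓ : ℕ) (hℓ : 1 ≤ ℓ) (q : ℝ) (hq : 0 < q) (hq1 : q < 1)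
    (Z : Hsp ℓ →L[ℂ] Hsp ℓ)
    (hZ : ∀ γ : Gamma ℓ,
      Z (e ℓ γ) = ((q ^ (∑ j : Fin ℓ, γ.1 j) : ℝ) : ℂ) • e ℓ (γ + eps ℓ (Fin.last ℓ)))
    (Q : Hsp ℓ →L[ℂ] Hsp ℓ)
    (hQ1 : ∀ γ : Gamma ℓ, γ.1 = 0 → Q (e ℓ γ) = e ℓ γ)
    (hQ2 : ∀ γ : Gamma ℓ, γ.1 ≠ 0 → Q (e ℓ γ) = 0) :
    (ContinuousLinearMap.adjoint (Q ∘L Z + (1 - Q))) ∘L (Q ∘L Z + (1 - Q)) = 1 ∧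
    (Q ∘L Z + (1 - Q)) ∘L (ContinuousLinearMap.adjoint (Q ∘L Z + (1 - Q))) = 1 ∧
    ∀ γ : Gamma ℓ,
      (γ.1 = 0 → (Q ∘L Z + (1 - Q)) (e ℓ γ) = e ℓ (γ + eps ℓ (Fin.last ℓ))) ∧
      (γ.1 ≠ 0 → (Q ∘L Z + (1 - Q)) (e ℓ γ) = e ℓ γ) := by
  have heps : eps ℓ (Fin.last ℓ) = (0, 1) := by simp [eps]
  have hshift : ∀ γ : Gamma ℓ, γ.1 = 0 →
      (Q ∘L Z + (1 - Q)) (e ℓ γ) = e ℓ (γ + eps ℓ (Fin.last ℓ)) := fun γ hγ => by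
    have hγ' : (γ + eps ℓ (Fin.last ℓ)).1 = 0 := by simp [heps, hγ]
    simp [hZ, hQ1 _ hγ, hQ1 _ hγ', hγ]
  have hfix : ∀ γ : Gamma ℓ, γ.1 ≠ 0 →
      (Q ∘L Z + (1 - Q)) (e ℓ γ) = e ℓ γ := fun γ hγ => by
    have hγ' : (γ + eps ℓ (Fin.last ℓ)).1 ≠ 0 := by simpa [heps] using hγ
    simp [hZ, hQ2 _ hγ, hQ2 _ hγ']
  have hperm : ∀ γ, (Q ∘L Z + (1 - Q)) (e ℓ γ) = e ℓ (shiftPerm ℓ γ) := fun γ => by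
    by_cases hγ : γ.1 = 0
    · rw [hshift γ hγ, heps]
      congr 1
      ext <;> simp [shiftPerm, hγ]
    · rw [hfix γ hγ]
      congr 1
      ext <;> simp [shiftPerm, hγ]
  have hadj := adjoint_apply_e (shiftPerm ℓ) hperm
  refine ⟨clm_ext_e fun γ => ?_, clm_ext_e fun γ => ?_, fun γ => ⟨hshift γ, hfix γ⟩⟩
  · rw [ContinuousLinearMap.comp_apply, hperm, hadj, Equiv.symm_apply_apply,
      one_apply_eq_self]
  · rw [ContinuousLinearMap.comp_apply, hadj, hperm, Equiv.apply_symm_apply,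
      one_apply_eq_self]
end
end
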